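/- arXiv:2106.10239 — 2 statements merged into one kernel-verified Lean document; each statement's English description precedes it below -/
import Mathlib

section
/- Let k be a field of characteristic two and let f ∈ k[X] be a monic polynomial of degree n ≥ 1. Then there exists a symmetric matrix M ∈ M_n(k) whose characteristic polynomial equals f if and only if f is NOT a product of pairwise distinct monic irreducible inseparable polynomials, i.e., it is not the case that f is squarefree and every monic irreducible factor of f is inseparable. -/
open Polynomial

universe u

/-- In characteristic two, a nondegenerate, non-alternating symmetric bilinear form whose quadratic
form takes only square values has an orthonormal basis. -/
theorem exists_orthonormal {k : Type u} [Field k] [CharP k 2] (n : ℕ) :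
    ∀ (V : Type u) [AddCommGroup V] [Module k V] [FiniteDimensional k V]
      (b : V →ₗ[k] V →ₗ[k] k), Module.finrank k V = n →
      (∀ x y, b x y = b y x) → (∀ x, (∀ y, b x y = 0) → x = 0) →
      (∀ x, IsSquare (b x x)) → (n = 0 ∨ ∃ x, b x x ≠ 0) →
      ∃ v : Fin n → V, ∀ i j, b (v i) (v j) = if i = j then 1 else 0 := by
  induction n with
  | zero => exact fun V _ _ _ b _ _ _ _ _ => ⟨Fin.elim0, fun i => i.elim0⟩
  | succ n ih =>
    intro V _ _ _ b hn hsymm hnd hsq hna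
    obtain ⟨e, he, hW⟩ : ∃ e, b e e = 1 ∧ (n = 0 ∨ ∃ x, b e x = 0 ∧ b x x ≠ 0) := by
      obtain ⟨x, hx⟩ := hna.resolve_left n.succ_ne_zero
      obtain ⟨r, hr⟩ := hsq x
      have hr0 : r ≠ 0 := by rintro rfl; simp [hr] at hx
      obtain ⟨e, he⟩ : ∃ e, b e e = 1 := ⟨r⁻¹ • x, by simp [hr, hr0]⟩
      by_cases h : n = 0 ∨ ∃ x, b e x = 0 ∧ b x x ≠ 0
      · exact ⟨e, he, h⟩
      push Not at h
      obtain ⟨hn0, halt⟩ := h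
      obtain ⟨y, hey, hy⟩ : ∃ y, b e y = 0 ∧ y ≠ 0 := by
        have hker : LinearMap.ker (b e) ≠ ⊥ := by
          intro hbot
          have := LinearMap.finrank_le_finrank_of_injective (LinearMap.ker_eq_bot.1 hbot)
          rw [hn, Module.finrank_self] at this
          omega
        obtain ⟨y, hy, hy0⟩ := Submodule.exists_mem_ne_zero_of_ne_bot hker
        exact ⟨y, hy, hy0⟩
      obtain ⟨w, hw⟩ : ∃ w, b y w ≠ 0 := by
        by_contra! h
        exact hy (hnd y h)
      let z := (b y w)⁻¹ • (w - b e w • e)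
      have hez : b e z = 0 := by simp [z, he]
      have hyz : b y z = 1 := by simp [z, hsymm y e, hey, hw]
      refine ⟨e + y, by simp [he, hey, hsymm y e, halt y hey], Or.inr ⟨e + z, ?_, ?_⟩⟩
      · simp [he, hez, hsymm y e, hey, hyz, CharTwo.add_self_eq_zero]
      · simp [he, hez, hsymm z e, halt z hez]
    have hfin : Module.finrank k (LinearMap.ker (b e)) = n := by
      have h1 := LinearMap.finrank_range_add_finrank_ker (b e)
      have h2 : LinearMap.range (b e) = ⊤ := by
        rw [LinearMap.range_eq_top]
        exact LinearMap.surjective (f := b e) (fun h => by simp [h] at he)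
      rw [h2, finrank_top, Module.finrank_self, hn] at h1
      omega
    obtain ⟨v, hv⟩ := ih (LinearMap.ker (b e))
      (b.compl₁₂ (LinearMap.ker (b e)).subtype (LinearMap.ker (b e)).subtype) hfin
      (fun x y => hsymm x y)
      (fun x hx => by
        refine Subtype.ext (hnd x fun y => ?_)
        have h := hx ⟨y - b e y • e, by simp [he]⟩
        have hex : b e x = 0 := x.2
        simpa [hsymm x e, hex] using h)
      (fun x => hsq x)
      (hW.imp_right fun ⟨x, hx, hxx⟩ => ⟨⟨x, hx⟩, hxx⟩)
    have hev (i) : b e (v i) = 0 := (v i).2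
    refine ⟨Fin.cons e fun i => (v i : V), fun i j => ?_⟩
    refine Fin.cases ?_ (fun i => ?_) i <;> refine Fin.cases ?_ (fun j => ?_) j
    · simp [he]
    · simp [hev, (Fin.succ_ne_zero j).symm]
    · simp [hsymm _ e, hev]
    · simpa using hv i j

/-- Applying Frobenius to all coordinates of a linearly independent family of vectors preserves
linear independence. -/
theorem LinearIndependent.frobenius_pi {k ι m : Type*} [Field k] (p : ℕ) [ExpChar k p]
    [Fintype m] {u : ι → m → k} (hu : LinearIndependent k u) :
    LinearIndependent k fun i j => u i j ^ p := by
  classical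
  obtain ⟨L, hL⟩ := LinearMap.exists_leftInverse_of_injective _
    (LinearMap.ker_eq_bot.2 hu)
  have hL' (i : ι) : L (u i) = Finsupp.single i 1 := by
    simpa using LinearMap.congr_fun hL (Finsupp.single i 1)
  rw [linearIndependent_iff']
  intro s c hc i hi
  have hpair (i' : ι) : ∑ j, L (Pi.single j 1) i ^ p * u i' j ^ p = if i' = i then 1 else 0 := by
    have h : ∑ j, L (Pi.single j 1) i * u i' j = if i' = i then 1 else 0 := by
      rw [← Finsupp.single_apply, ← hL']
      conv_rhs => rw [pi_eq_sum_univ' (u i')]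
      simp [Finsupp.finsetSum_apply, mul_comm]
    simp_rw [← mul_pow, ← frobenius_def, ← map_sum, h]
    split_ifs <;> simp
  calc c i = ∑ i' ∈ s, c i' * ∑ j, L (Pi.single j 1) i ^ p * u i' j ^ p := by
        simp [hpair, hi]
    _ = ∑ j, L (Pi.single j 1) i ^ p * (∑ i' ∈ s, c i' • fun j => u i' j ^ p) j := by
        simp only [Finset.mul_sum, Finset.sum_apply, Pi.smul_apply, smul_eq_mul]
        rw [Finset.sum_comm]
        exact Finset.sum_congr rfl fun _ _ => Finset.sum_congr rfl fun _ _ => by ring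
    _ = 0 := by simp only [hc, Pi.zero_apply, mul_zero, Finset.sum_const_zero]

open Matrix in
theorem Matrix.IsSymm.mul_self_apply_self {k m : Type*} [Field k] [CharP k 2] [Fintype m]
    {N : Matrix m m k} (hN : N.IsSymm) (i : m) : (N * N) i i = (N *ᵥ 1) i ^ 2 := by
  rw [mul_apply, mulVec, dotProduct, sum_pow_char]
  exact Finset.sum_congr rfl fun j _ => by rw [hN.apply i j]; simp [pow_two]

theorem Matrix.IsSymm.aeval {k m : Type*} [Field k] [Fintype m] [DecidableEq m]
    {M : Matrix m m k} (hM : M.IsSymm) (p : k[X]) : (Polynomial.aeval M p).IsSymm := by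
  induction p using Polynomial.induction_on' with
  | add p q hp hq => simpa using hp.add hq
  | monomial n a =>
    rw [aeval_monomial, ← Algebra.smul_def]
    exact (hM.pow n).smul a

open Matrix in
theorem not_squarefree_charpoly_of_derivative_eq_zero {k m : Type*} [Field k] [CharP k 2]
    [Fintype m] [DecidableEq m] [Nonempty m] {M : Matrix m m k} (hM : M.IsSymm)
    (hder : derivative M.charpoly = 0) : ¬ Squarefree M.charpoly := by
  intro hsq
  set f := M.charpoly
  let I : Ideal k[X] :=
    { carrier := {p | aeval M p *ᵥ 1 = 0}
      add_mem' := fun {p q} hp hq => by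
        simp only [Set.mem_ofPred_eq] at hp hq ⊢
        rw [map_add, add_mulVec, hp, hq, add_zero]
      zero_mem' := by simp
      smul_mem' := fun c p hp => by
        simp only [Set.mem_ofPred_eq] at hp ⊢
        rw [smul_eq_mul, map_mul, ← mulVec_mulVec, hp, mulVec_zero] }
  have hI (p : k[X]) : p ∈ I ↔ aeval M p *ᵥ 1 = 0 := Iff.rfl
  obtain ⟨h, hh⟩ := (IsPrincipalIdealRing.principal I).principal
  have hIh (p : k[X]) : aeval M p *ᵥ 1 = 0 ↔ h ∣ p := by
    rw [← hI, hh, ← Ideal.mem_span_singleton]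
  have hf : h ∣ f := by rw [← hIh, Matrix.aeval_self_charpoly, zero_mulVec]
  have hf0 : f ≠ 0 := (charpoly_monic M).ne_zero
  have hh0 : h ≠ 0 := ne_zero_of_dvd_ne_zero hf0 hf
  have hind : LinearIndependent k fun i : Fin h.natDegree =>
      aeval M (X ^ (i : ℕ) : k[X]) *ᵥ (1 : m → k) := by
    rw [Fintype.linearIndependent_iff]
    intro c hc i
    have hdvd : h ∣ ∑ i : Fin h.natDegree, C (c i) * X ^ (i : ℕ) := by
      rw [← hIh, map_sum, sum_mulVec, ← hc]
      refine Finset.sum_congr rfl fun i _ => ?_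
      rw [map_mul, aeval_C, ← Algebra.smul_def, smul_mulVec]
    have hzero := eq_zero_of_dvd_of_degree_lt hdvd (by
      rw [degree_eq_natDegree hh0]
      exact degree_sum_fin_lt c)
    have := congrArg (fun p => p.coeff i) hzero
    simpa [finsetSum_coeff, coeff_X_pow, Fin.val_inj] using this
  let D : k[X] →ₗ[k] m → k :=
    LinearMap.pi (fun i => Matrix.entryLinearMap k k i i) ∘ₗ (aeval (M ^ 2)).toLinearMap
  have hD (p : k[X]) : D p = fun i => (aeval M (expand k 2 p)) i i := by
    ext i
    simp [D, expand_aeval]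
  have hDsq (p : k[X]) : D (p.map (frobenius k 2)) = fun i => (aeval M p *ᵥ 1) i ^ 2 := by
    rw [hD, ← map_expand, map_frobenius_expand]
    ext i
    rw [map_pow, pow_two, (hM.aeval p).mul_self_apply_self]
  have hDX (i : ℕ) : D (X ^ i) = fun j => (aeval M (X ^ i : k[X]) *ᵥ 1) j ^ 2 := by
    rw [← hDsq]
    simp
  set h₂ := h.map (frobenius k 2) with hh₂
  have hDh (q : k[X]) : D (h₂ * q) = 0 := by
    induction q using Polynomial.induction_on' with
    | add p q hp hq => rw [mul_add, map_add, hp, hq, add_zero]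
    | monomial n a =>
      have : h₂ * monomial n a = a • (h * X ^ n).map (frobenius k 2) := by
        rw [← C_mul_X_pow_eq_monomial, smul_eq_C_mul, hh₂, Polynomial.map_mul]
        simp
        ring
      rw [this, map_smul, hDsq, (hIh _).2 (dvd_mul_right h _)]
      ext; simp
  let F := contract 2 f
  have hF : expand k 2 F = f := expand_contract 2 hder two_ne_zero
  have hDF : D F = 0 := by
    rw [hD, hF, Matrix.aeval_self_charpoly]
    rfl
  have hr : D (F % h₂) = 0 := by
    have := congrArg D (EuclideanDomain.mod_add_div F h₂)
    rwa [map_add, hDh, add_zero, hDF] at this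
  have hdvd : h₂ ∣ F := by
    rw [← EuclideanDomain.mod_eq_zero]
    have hdeg : (F % h₂).degree < h.natDegree := by
      rw [← degree_eq_natDegree hh0, ← degree_map h (frobenius k 2)]
      exact degree_mod_lt _ (by simpa [hh₂] using hh0)
    have hli := Fintype.linearIndependent_iff.1 (hind.frobenius_pi 2)
    ext i
    by_cases hi : i < h.natDegree
    · refine hli (fun i => (F % h₂).coeff i) ?_ ⟨i, hi⟩
      have hsum : F % h₂ = ∑ i : Fin h.natDegree, monomial (i : ℕ) ((F % h₂).coeff i) := by
        rw [sum_fin (fun i c => monomial i c) (by simp) hdeg, sum_monomial_eq]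
      rw [← hr]
      conv_rhs => rw [hsum, map_sum]
      refine Finset.sum_congr rfl fun i _ => ?_
      rw [← C_mul_X_pow_eq_monomial, ← smul_eq_C_mul, map_smul, hDX]
    · rw [coeff_zero]
      exact coeff_eq_zero_of_degree_lt (hdeg.trans_le (by exact_mod_cast not_lt.1 hi))
  have hunit : IsUnit h := by
    have hexp : expand k 2 h₂ = h * h := by
      rw [hh₂, ← map_expand, map_frobenius_expand, pow_two]
    have hdvd2 := map_dvd (expand k 2) hdvd
    rw [hexp, hF] at hdvd2
    exact hsq h hdvd2
  have h1 : aeval M (1 : k[X]) *ᵥ (1 : m → k) = 0 := (hIh 1).2 hunit.dvd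
  rw [map_one, one_mulVec] at h1
  exact one_ne_zero h1

/-- A nondegenerate symmetric bilinear form whose associated quadratic form takes only square
values, together with a self-adjoint endomorphism whose characteristic polynomial is `f`. -/
structure SelfAdjointModel {k : Type u} [Field k] (f : k[X]) where
  V : Type u
  [addCommGroup : AddCommGroup V]
  [module : Module k V]
  [finiteDimensional : FiniteDimensional k V]
  form : V →ₗ[k] V →ₗ[k] k
  endo : V →ₗ[k] V
  symm : ∀ x y, form x y = form y x
  nondegenerate : ∀ x, (∀ y, form x y = 0) → x = 0
  isSquare : ∀ x, IsSquare (form x x)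
  selfAdjoint : ∀ x y, form (endo x) y = form x (endo y)
  charpoly_eq : endo.charpoly = f

namespace SelfAdjointModel

attribute [instance] addCommGroup module finiteDimensional

variable {k : Type u} [Field k]

/-- The trivial model on the zero space. -/
noncomputable def one : SelfAdjointModel (1 : k[X]) where
  V := PUnit
  form := 0
  endo := 0
  symm _ _ := rfl
  nondegenerate _ _ := Subsingleton.elim _ _
  isSquare _ := by simp
  selfAdjoint _ _ := rfl
  charpoly_eq := by
    refine (LinearMap.charpoly_monic _).natDegree_eq_zero.mp ?_
    rw [LinearMap.charpoly_natDegree, Module.finrank_zero_of_subsingleton]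

/-- The orthogonal direct sum of two models, in characteristic two. -/
noncomputable def prod [CharP k 2] {f g : k[X]} (M : SelfAdjointModel f)
    (N : SelfAdjointModel g) : SelfAdjointModel (f * g) where
  V := M.V × N.V
  form := M.form.compl₁₂ (LinearMap.fst k _ _) (LinearMap.fst k _ _) +
    N.form.compl₁₂ (LinearMap.snd k _ _) (LinearMap.snd k _ _)
  endo := M.endo.prodMap N.endo
  symm x y := by simp [M.symm x.1, N.symm x.2]
  nondegenerate x hx := by
    refine Prod.ext (M.nondegenerate _ fun y => ?_) (N.nondegenerate _ fun y => ?_)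
    · simpa using hx (y, 0)
    · simpa using hx (0, y)
  isSquare x := by
    obtain ⟨r, hr⟩ := M.isSquare x.1
    obtain ⟨s, hs⟩ := N.isSquare x.2
    exact ⟨r + s, by simp [hr, hs, CharTwo.add_mul_self]⟩
  selfAdjoint x y := by simp [M.selfAdjoint, N.selfAdjoint]
  charpoly_eq := by rw [LinearMap.charpoly_prodMap, M.charpoly_eq, N.charpoly_eq]

/-- The model on `k[X] / (g)` given by `(x, y) ↦ T (x * y)` and multiplication by the root. -/
noncomputable def ofFunctional {g : k[X]} (hg : g.Monic) (T : AdjoinRoot g →ₗ[k] k)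
    (hT : ∀ x, (∀ y, T (x * y) = 0) → x = 0) (hsq : ∀ x, IsSquare (T (x * x))) :
    SelfAdjointModel g where
  V := AdjoinRoot g
  finiteDimensional := (AdjoinRoot.powerBasis hg.ne_zero).finite
  form := (LinearMap.mul k (AdjoinRoot g)).compr₂ T
  endo := LinearMap.mulLeft k (AdjoinRoot.root g)
  symm x y := by simp [mul_comm]
  nondegenerate := by simpa using hT
  isSquare := by simpa using hsq
  selfAdjoint x y := by simp [mul_left_comm, mul_assoc]
  charpoly_eq := by
    let B := AdjoinRoot.powerBasis hg.ne_zero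
    have := B.finite
    have := Module.Free.of_basis B.basis
    rw [← LinearMap.charpoly_toMatrix _ B.basis]
    have h := charpoly_leftMulMatrix B
    rw [AdjoinRoot.minpoly_powerBasis_gen_of_monic hg] at h
    exact h

/-- The form is not alternating. -/
def NonAlternating {f : k[X]} (M : SelfAdjointModel f) : Prop :=
  ∃ x, M.form x x ≠ 0

theorem NonAlternating.prod [CharP k 2] {f g : k[X]} {M : SelfAdjointModel f}
    (hM : M.NonAlternating) (N : SelfAdjointModel g) : (M.prod N).NonAlternating := by
  obtain ⟨x, hx⟩ := hM
  refine ⟨(x, 0), ?_⟩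
  change M.form x x + N.form 0 0 ≠ 0
  simpa using hx

theorem exists_nonAlternating_of_separable [CharP k 2] {g : k[X]} (hg : g.Monic)
    (hirr : Irreducible g) (hsep : g.Separable) :
    ∃ M : SelfAdjointModel g, M.NonAlternating := by
  have : Fact (Irreducible g) := ⟨hirr⟩
  have := (AdjoinRoot.powerBasis hg.ne_zero).finite
  have : Algebra.IsSeparable k (AdjoinRoot g) := by
    have hroot : IsSeparable k (AdjoinRoot.root g) := by
      rwa [IsSeparable, AdjoinRoot.minpoly_root hg.ne_zero, hg.leadingCoeff, inv_one, C_1, mul_one]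
    have := (IntermediateField.isSeparable_adjoin_simple_iff_isSeparable k _).2 hroot
    refine ⟨fun x => IntermediateField.isSeparable_of_mem_isSeparable k _
      (L := IntermediateField.adjoin k {AdjoinRoot.root g})
      (IntermediateField.algebra_adjoin_le_adjoin k _ ?_)⟩
    rw [AdjoinRoot.adjoinRoot_eq_top]
    trivial
  have htr (x : AdjoinRoot g) :
      Algebra.trace k (AdjoinRoot g) (x * x) = Algebra.trace k (AdjoinRoot g) x ^ 2 := by
    have : CharP (AlgebraicClosure k) 2 := charP_of_injective_algebraMap
      (algebraMap k (AlgebraicClosure k)).injective 2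
    apply (algebraMap k (AlgebraicClosure k)).injective
    rw [map_pow, trace_eq_sum_embeddings, trace_eq_sum_embeddings, sum_pow_char]
    simp [pow_two]
  have hne := Algebra.trace_ne_zero k (AdjoinRoot g)
  obtain ⟨z, hz⟩ : ∃ z, Algebra.trace k (AdjoinRoot g) z ≠ 0 := by
    by_contra! h
    exact hne (LinearMap.ext h)
  refine ⟨ofFunctional hg (Algebra.trace k (AdjoinRoot g)) (fun x hx => ?_)
    fun x => ⟨Algebra.trace k _ x, by rw [htr, pow_two]⟩, z, ?_⟩
  · by_contra h
    exact hz (by simpa [h] using hx (x⁻¹ * z))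
  · change Algebra.trace k _ (z * z) ≠ 0
    rw [htr]
    exact pow_ne_zero 2 hz

theorem two_le_natDegree_of_derivative_eq_zero [CharP k 2] {g : k[X]} (hg : g.Monic)
    (hpos : 0 < g.natDegree) (hder : derivative g = 0) :
    (g.natDegree : k) = 0 ∧ 2 ≤ g.natDegree := by
  have h : (g.natDegree : k) = 0 := by
    have h := congrArg (fun p => p.coeff (g.natDegree - 1)) hder
    simpa [coeff_derivative, Nat.sub_add_cancel hpos, hg.coeff_natDegree, Nat.cast_sub hpos]
      using h
  refine ⟨h, ?_⟩
  by_contra! h2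
  have : g.natDegree = 1 := by omega
  simp [this] at h

/-- The coefficient of `X ^ i` in the reduced representative. -/
noncomputable def coeffModByMonic {g : k[X]} (hg : g.Monic) (i : ℕ) : AdjoinRoot g →ₗ[k] k :=
  lcoeff k i ∘ₗ AdjoinRoot.modByMonicHom hg

@[simp]
theorem coeffModByMonic_mk {g : k[X]} (hg : g.Monic) (i : ℕ) (p : k[X]) :
    coeffModByMonic hg i (AdjoinRoot.mk g p) = (p %ₘ g).coeff i := rfl

theorem nonempty_of_derivative_eq_zero [CharP k 2] {g : k[X]} (hg : g.Monic)
    (hirr : Irreducible g) (hder : derivative g = 0) : Nonempty (SelfAdjointModel g) := by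
  have : Fact (Irreducible g) := ⟨hirr⟩
  obtain ⟨hd, h2⟩ := two_le_natDegree_of_derivative_eq_zero hg hirr.natDegree_pos hder
  refine ⟨ofFunctional hg (coeffModByMonic hg (g.natDegree - 1)) (fun x hx => ?_) fun x => ?_⟩
  · by_contra h
    have h1 := hx (x⁻¹ * AdjoinRoot.mk g (X ^ (g.natDegree - 1)))
    rw [mul_inv_cancel_left₀ h, coeffModByMonic_mk, (modByMonic_eq_self_iff hg).2] at h1
    · simp at h1
    · rw [degree_X_pow, degree_eq_natDegree hg.ne_zero]
      exact_mod_cast (by omega)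
  · obtain ⟨p, rfl⟩ := AdjoinRoot.mk_surjective x
    rw [← map_mul, coeffModByMonic_mk]
    have key : derivative (p * p %ₘ g) = 0 := by
      have h := congrArg derivative (modByMonic_add_div (p * p) g)
      simp only [derivative_add, derivative_mul, hder, zero_mul, zero_add, mul_comm p,
        CharTwo.add_self_eq_zero] at h
      have hdvd : g ∣ derivative (p * p %ₘ g) :=
        ⟨-derivative (p * p /ₘ g), by linear_combination h⟩
      exact eq_zero_of_dvd_of_degree_lt hdvd
        ((degree_derivative_le).trans_lt (degree_modByMonic_lt _ hg))
    have h := congrArg (fun q => q.coeff (g.natDegree - 2)) key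
    have e : g.natDegree - 2 + 1 = g.natDegree - 1 := by omega
    simp only [coeff_derivative, e, coeff_zero] at h
    have h3 : ((g.natDegree - 2 : ℕ) : k) + 1 = 1 := by
      rw [Nat.cast_sub h2, hd]
      simp [CharTwo.two_eq_zero]
    rw [h3, mul_one] at h
    simp [h]

theorem exists_nonAlternating_sq [CharP k 2] {g : k[X]} (hg : g.Monic)
    (hirr : Irreducible g) (h2 : 2 ≤ g.natDegree) :
    ∃ M : SelfAdjointModel (g ^ 2), M.NonAlternating := by
  classical
  have hg2 : (g ^ 2).Monic := hg.pow 2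
  have hlt (r : k[X]) (hr : r.natDegree < 2 * g.natDegree) : r %ₘ g ^ 2 = r := by
    rw [modByMonic_eq_self_iff hg2]
    apply degree_lt_degree
    rwa [natDegree_pow]
  let T := coeffModByMonic hg2 (2 * (g.natDegree - 1))
  have hT (p : k[X]) : T (AdjoinRoot.mk (g ^ 2) p * AdjoinRoot.mk (g ^ 2) p) =
      (p %ₘ g).coeff (g.natDegree - 1) * (p %ₘ g).coeff (g.natDegree - 1) := by
    have hr : (p %ₘ g).natDegree ≤ g.natDegree - 1 := by
      have := natDegree_modByMonic_lt p hg (by rintro rfl; simp at h2)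
      omega
    have hr2 := natDegree_mul_le (p := p %ₘ g) (q := p %ₘ g)
    rw [← map_mul]
    have : AdjoinRoot.mk (g ^ 2) (p * p) = AdjoinRoot.mk (g ^ 2) ((p %ₘ g) * (p %ₘ g)) := by
      rw [AdjoinRoot.mk_eq_mk]
      refine ⟨(p /ₘ g) ^ 2, ?_⟩
      linear_combination (-p - p %ₘ g - g * (p /ₘ g)) * (modByMonic_add_div p g) +
        (g * (p /ₘ g) * (p %ₘ g)) * (CharTwo.two_eq_zero (R := k[X]))
    rw [this, coeffModByMonic_mk, hlt _ (by omega), two_mul, coeff_mul_add_eq_of_natDegree_le hr hr]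
  refine ⟨ofFunctional hg2 T (fun x hx => ?_) fun x => ?_,
    AdjoinRoot.mk _ (X ^ (g.natDegree - 1)), ?_⟩
  · obtain ⟨p, rfl⟩ := AdjoinRoot.mk_surjective x
    by_contra h
    rw [AdjoinRoot.mk_eq_zero] at h
    obtain ⟨a, c, hac⟩ : ∃ a c, g = p * a + g ^ 2 * c := by
      have hdvd : EuclideanDomain.gcd p (g ^ 2) ∣ g ^ 2 := EuclideanDomain.gcd_dvd_right _ _
      obtain ⟨i, hi, hassoc⟩ := (dvd_prime_pow hirr.prime 2).1 hdvd
      have hi1 : i ≠ 2 := by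
        rintro rfl
        exact h (hassoc.symm.dvd.trans (EuclideanDomain.gcd_dvd_left _ _))
      have : EuclideanDomain.gcd p (g ^ 2) ∣ g :=
        hassoc.dvd.trans ((pow_dvd_pow g (by omega : i ≤ 1)).trans (pow_one g).dvd)
      obtain ⟨d, hd⟩ := this
      refine ⟨EuclideanDomain.gcdA p (g ^ 2) * d, EuclideanDomain.gcdB p (g ^ 2) * d, ?_⟩
      conv_lhs => rw [hd, EuclideanDomain.gcd_eq_gcd_ab]
      ring
    have h1 := hx (AdjoinRoot.mk _ (a * X ^ (g.natDegree - 2)))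
    have hdeg : (g * X ^ (g.natDegree - 2)).natDegree = 2 * (g.natDegree - 1) := by
      rw [natDegree_mul_X_pow _ hg.ne_zero]
      omega
    have : AdjoinRoot.mk (g ^ 2) (p * (a * X ^ (g.natDegree - 2))) =
        AdjoinRoot.mk (g ^ 2) (g * X ^ (g.natDegree - 2)) := by
      rw [AdjoinRoot.mk_eq_mk]
      refine ⟨-(c * X ^ (g.natDegree - 2)), ?_⟩
      linear_combination (-X ^ (g.natDegree - 2)) * hac
    rw [← map_mul, this, coeffModByMonic_mk, hlt _ (by omega), ← hdeg,
      (hg.mul (monic_X_pow _)).coeff_natDegree] at h1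
    exact one_ne_zero h1
  · obtain ⟨p, rfl⟩ := AdjoinRoot.mk_surjective x
    exact ⟨_, hT p⟩
  · change T (_ * _) ≠ 0
    rw [hT, (modByMonic_eq_self_iff hg).2]
    · simp
    · rw [degree_X_pow, degree_eq_natDegree hg.ne_zero]
      exact_mod_cast (by omega)

theorem _root_.Polynomial.Monic.induction_on_irreducible {P : k[X] → Prop} (one : P 1)
    (mul : ∀ g q : k[X], g.Monic → Irreducible g → q.Monic → P q → P (g * q)) {f : k[X]}
    (hf : f.Monic) : P f := by
  induction hd : f.natDegree using Nat.strong_induction_on generalizing f with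
  | _ d ih =>
    by_cases hu : IsUnit f
    · rwa [hf.eq_one_of_isUnit hu]
    · obtain ⟨g, hg, hirr, q, rfl⟩ := exists_monic_irreducible_factor f hu
      have hq : q.Monic := hg.of_mul_monic_left hf
      refine mul g q hg hirr hq (ih _ ?_ hq rfl)
      rw [← hd, hg.natDegree_mul hq]
      have := hirr.natDegree_pos
      omega

theorem _root_.Irreducible.derivative_eq_zero_of_not_separable {g : k[X]}
    (hirr : Irreducible g) (hsep : ¬ g.Separable) : derivative g = 0 := by
  rwa [separable_iff_derivative_ne_zero hirr, not_not] at hsep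

theorem nonempty_of_monic [CharP k 2] {f : k[X]} (hf : f.Monic) :
    Nonempty (SelfAdjointModel f) := by
  refine hf.induction_on_irreducible (P := fun f => Nonempty (SelfAdjointModel f)) ⟨one⟩ ?_
  rintro g q hg hirr - ⟨N⟩
  by_cases hsep : g.Separable
  · obtain ⟨M, -⟩ := exists_nonAlternating_of_separable hg hirr hsep
    exact ⟨M.prod N⟩
  · obtain ⟨M⟩ := nonempty_of_derivative_eq_zero hg hirr
      (hirr.derivative_eq_zero_of_not_separable hsep)
    exact ⟨M.prod N⟩

theorem exists_nonAlternating [CharP k 2] {f : k[X]} (hf : f.Monic)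
    (h : ¬ (Squarefree f ∧ ∀ g : k[X], g.Monic → Irreducible g → g ∣ f → ¬ g.Separable)) :
    ∃ M : SelfAdjointModel f, M.NonAlternating := by
  by_cases hsep : ∃ g : k[X], g.Monic ∧ Irreducible g ∧ g ∣ f ∧ g.Separable
  · obtain ⟨g, hg, hirr, ⟨q, rfl⟩, hgs⟩ := hsep
    obtain ⟨M, hM⟩ := exists_nonAlternating_of_separable hg hirr hgs
    obtain ⟨N⟩ := nonempty_of_monic (hg.of_mul_monic_left hf)
    exact ⟨M.prod N, hM.prod N⟩
  · have hinsep : ∀ g : k[X], g.Monic → Irreducible g → g ∣ f → ¬ g.Separable :=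
      fun g hg hirr hdvd hgs => hsep ⟨g, hg, hirr, hdvd, hgs⟩
    obtain ⟨x, hx, hxu⟩ : ∃ x, x * x ∣ f ∧ ¬ IsUnit x := by
      by_contra! hsq
      exact h ⟨fun x hx => hsq x hx, hinsep⟩
    obtain ⟨g, hg, hirr, hgx⟩ := exists_monic_irreducible_factor x hxu
    obtain ⟨q, rfl⟩ : g ^ 2 ∣ f := by
      rw [pow_two]
      exact (mul_dvd_mul hgx hgx).trans hx
    have hder := hirr.derivative_eq_zero_of_not_separable
      (hinsep g hg hirr ((dvd_pow_self g two_ne_zero).mul_right q))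
    obtain ⟨M, hM⟩ := exists_nonAlternating_sq hg hirr
      (two_le_natDegree_of_derivative_eq_zero hg hirr.natDegree_pos hder).2
    obtain ⟨N⟩ := nonempty_of_monic ((hg.pow 2).of_mul_monic_left hf)
    exact ⟨M.prod N, hM.prod N⟩

/-- Expressing a model with a non-alternating form in an orthonormal basis gives a symmetric
matrix. -/
theorem NonAlternating.exists_isSymm_charpoly_eq [CharP k 2] {f : k[X]}
    {M : SelfAdjointModel f} (hM : M.NonAlternating) :
    ∃ A : Matrix (Fin f.natDegree) (Fin f.natDegree) k, A.IsSymm ∧ A.charpoly = f := by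
  have hfin : Module.finrank k M.V = f.natDegree := by
    rw [← M.endo.charpoly_natDegree, M.charpoly_eq]
  obtain ⟨v, hv⟩ := exists_orthonormal _ M.V M.form hfin M.symm M.nondegenerate M.isSquare
    (Or.inr hM)
  have hli : LinearIndependent k v := by
    rw [Fintype.linearIndependent_iff]
    intro c hc i
    simpa [hv] using congrArg (M.form (v i)) hc
  have hspan : ⊤ ≤ Submodule.span k (Set.range v) :=
    (hli.span_eq_top_of_card_eq_finrank' (by simp [hfin])).ge
  let B := Module.Basis.mk hli hspan
  have hB (x : M.V) (i) : B.repr x i = M.form (v i) x := by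
    conv_rhs => rw [← B.sum_repr x]
    simp [B, hv]
  refine ⟨LinearMap.toMatrix B B M.endo, ?_, ?_⟩
  · ext i j
    rw [Matrix.transpose_apply, LinearMap.toMatrix_apply, LinearMap.toMatrix_apply, hB, hB,
      ← M.selfAdjoint, M.symm]
    simp [B]
  · rw [LinearMap.charpoly_toMatrix, M.charpoly_eq]

end SelfAdjointModel

theorem charpoly_symmetric_matrix_iff
    {k : Type*} [Field k] [CharP k 2] (n : ℕ) (hn : 1 ≤ n)
    (f : Polynomial k) (hmonic : f.Monic) (hdeg : f.natDegree = n) :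
    (∃ M : Matrix (Fin n) (Fin n) k, M.IsSymm ∧ M.charpoly = f) ↔
      ¬ (Squarefree f ∧
        ∀ g : Polynomial k, g.Monic → Irreducible g → g ∣ f → ¬ g.Separable) := by
  constructor
  · rintro ⟨M, hM, rfl⟩ ⟨hsq, hinsep⟩
    have : Nonempty (Fin n) := ⟨⟨0, hn⟩⟩
    refine not_squarefree_charpoly_of_derivative_eq_zero hM ?_ hsq
    revert hinsep
    refine hmonic.induction_on_irreducible (P := fun f => (∀ g : k[X], g.Monic → Irreducible g →
      g ∣ f → ¬ g.Separable) → derivative f = 0) (fun _ => derivative_one) ?_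
    intro g q hg hirr _ hq hinsep
    rw [derivative_mul, hq fun g' h1 h2 h3 => hinsep g' h1 h2 (h3.mul_left g),
      hirr.derivative_eq_zero_of_not_separable (hinsep g hg hirr (dvd_mul_right g q))]
    simp
  · intro h
    obtain ⟨M, hM⟩ := SelfAdjointModel.exists_nonAlternating hmonic h
    subst hdeg
    exact hM.exists_isSymm_charpoly_eq
end

section
/- Let k be a field of characteristic two and let α be an element of an algebraic closure of k that is algebraic of degree n over k, and assume the minimal polynomial of α over k is separable. Then there exists a symmetric matrix M ∈ M_n(k) such that α is a root of the characteristic polynomial of M, i.e., evaluating the characteristic polynomial of M at α (via the algebra map k[X] → algebraic closure of k) gives 0. -/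
open Polynomial

/-- In characteristic two, the trace of a finite separable extension commutes with squaring. -/
theorem Algebra.trace_sq_of_charTwo (k : Type*) {K : Type*} [Field k] [Field K] [Algebra k K]
    [CharP k 2] [FiniteDimensional k K] [Algebra.IsSeparable k K] (x : K) :
    Algebra.trace k K (x * x) = Algebra.trace k K x ^ 2 := by
  have : CharP (AlgebraicClosure k) 2 := charP_of_injective_algebraMap
    (algebraMap k (AlgebraicClosure k)).injective 2
  apply (algebraMap k (AlgebraicClosure k)).injective
  rw [map_pow, trace_eq_sum_embeddings (AlgebraicClosure k),
    trace_eq_sum_embeddings (AlgebraicClosure k), sum_pow_char 2]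
  exact Finset.sum_congr rfl fun σ _ => by rw [map_mul, sq]

/-- A nondegenerate symmetric bilinear form whose diagonal is the square of a nonzero linear
functional admits an orthonormal family of full size, in characteristic two. -/
theorem LinearMap.BilinForm.exists_orthonormal_of_apply_self_eq_sq
    {k : Type*} [Field k] (n : ℕ) {V : Type*} [AddCommGroup V] [Module k V]
    [FiniteDimensional k V] (hV : Module.finrank k V = n) (B : LinearMap.BilinForm k V)
    (hsymm : ∀ x y, B x y = B y x) (hnd : ∀ x, (∀ y, B x y = 0) → x = 0)
    (l : V →ₗ[k] k) (hl : ∀ x, B x x = l x ^ 2) (hl0 : n = 0 ∨ l ≠ 0) :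
    ∃ b : Fin n → V, ∀ i j, B (b i) (b j) = if i = j then 1 else 0 := by
  induction n generalizing V with
  | zero => exact ⟨Fin.elim0, fun i => i.elim0⟩
  | succ m ih =>
    have hl0 : l ≠ 0 := hl0.resolve_left m.succ_ne_zero
    obtain ⟨v₀, hv₀⟩ : ∃ v, l v = 1 := LinearMap.surjective hl0 1
    have hunit : ∀ v, l v = 1 → B v v = 1 := fun v hv => by rw [hl, hv, one_pow]
    have hker : ∀ v, l v = 1 → ∀ x, x - B v x • v ∈ ker (B v) := fun v hv x => by
      simp [hunit v hv]
    obtain ⟨v, hv, hm⟩ : ∃ v, l v = 1 ∧ (m = 0 ∨ l.domRestrict (ker (B v)) ≠ 0) := by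
      by_cases hm : m = 0
      · exact ⟨v₀, hv₀, .inl hm⟩
      by_contra! H
      have hB : ∀ v, l v = 1 → ∀ x, B v x = l x := fun v hv x => by
        have h := LinearMap.congr_fun (H v hv).2 ⟨_, hker v hv x⟩
        simp [hv] at h
        exact (sub_eq_zero.mp h).symm
      obtain ⟨u, hu, hu0⟩ : ∃ u ∈ ker l, u ≠ 0 := by
        apply Submodule.exists_mem_ne_zero_of_ne_bot
        intro hbot
        have := Module.Dual.finrank_ker_add_one_of_ne_zero (f := l) hl0
        rw [hbot, finrank_bot] at this
        omega
      refine hu0 (hnd u fun y => ?_)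
      have h := hB (v₀ + u) (by simp [hv₀, mem_ker.mp hu]) y
      rw [map_add, LinearMap.add_apply, hB v₀ hv₀] at h
      simpa using h
    have hBv : B v ≠ 0 := fun h => by simpa [h] using hunit v hv
    have hW : Module.finrank k (ker (B v)) = m := by
      have := Module.Dual.finrank_ker_add_one_of_ne_zero (f := B v) hBv
      omega
    obtain ⟨b, hb⟩ := ih hW (B.restrict (ker (B v))) (fun x y => hsymm x y)
      (fun x hx => Subtype.ext <| hnd x fun y => by
        have h : B x (y - B v y • v) = 0 := hx ⟨_, hker v hv y⟩
        have hxv : B x v = 0 := (hsymm x v).trans x.2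
        simpa [hxv] using h)
      (l.domRestrict _) (fun x => hl x) hm
    refine ⟨Fin.cons v fun i => b i, fun i j => ?_⟩
    refine Fin.cases ?_ (fun i => ?_) i <;> refine Fin.cases ?_ (fun j => ?_) j
    · simpa using hunit v hv
    · simp [(Fin.succ_ne_zero j).symm]
    · simp [hsymm _ v]
    · simpa using hb i j

/-- A finite separable extension in characteristic two has a basis that is orthonormal for the
trace form. -/
theorem Algebra.exists_basis_traceForm_orthonormal_of_charTwo (k K : Type*) [Field k] [Field K]
    [Algebra k K] [CharP k 2] [FiniteDimensional k K] [Algebra.IsSeparable k K] {n : ℕ}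
    (hn : Module.finrank k K = n) :
    ∃ b : Module.Basis (Fin n) k K,
      ∀ i j, Algebra.traceForm k K (b i) (b j) = if i = j then 1 else 0 := by
  obtain ⟨b, hb⟩ := LinearMap.BilinForm.exists_orthonormal_of_apply_self_eq_sq n hn
    (Algebra.traceForm k K) (fun x y => (Algebra.traceForm_isSymm k).eq x y)
    (traceForm_nondegenerate k K).1 (Algebra.trace k K) (Algebra.trace_sq_of_charTwo k)
    (.inr (Algebra.trace_ne_zero k K))
  have hli : LinearIndependent k b := by
    rw [Fintype.linearIndependent_iff]
    intro g hg i
    simpa [hb] using congrArg (Algebra.traceForm k K (b i)) hg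
  have : Nonempty (Fin n) := ⟨⟨0, hn ▸ Module.finrank_pos⟩⟩
  refine ⟨basisOfLinearIndependentOfCardEqFinrank hli (by simp [hn]), ?_⟩
  simpa using hb

/-- The matrix of a multiplication map in an orthonormal basis for the trace form is symmetric. -/
theorem Algebra.leftMulMatrix_isSymm_of_traceForm_orthonormal {k K ι : Type*} [Field k] [Field K]
    [Algebra k K] [Fintype ι] [DecidableEq ι] (b : Module.Basis ι k K)
    (hb : ∀ i j, Algebra.traceForm k K (b i) (b j) = if i = j then 1 else 0) (x : K) :
    (Algebra.leftMulMatrix b x).IsSymm := by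
  have hrepr : ∀ y i, b.repr y i = Algebra.traceForm k K (b i) y := fun y i => by
    conv_rhs => rw [← b.sum_repr y]
    simp only [map_sum, map_smul, hb]
    simp
  refine Matrix.IsSymm.ext fun i j => ?_
  rw [Algebra.leftMulMatrix_eq_repr_mul, Algebra.leftMulMatrix_eq_repr_mul, hrepr, hrepr,
    Algebra.traceForm_apply, Algebra.traceForm_apply]
  congr 1
  ring

theorem eigenvalue_symmetric_matrix_of_separable
    {k : Type*} [Field k] [CharP k 2] (n : ℕ) (hn : 1 ≤ n)
    (α : AlgebraicClosure k) (hint : IsIntegral k α)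
    (hdeg : (minpoly k α).natDegree = n)
    (hsep : (minpoly k α).Separable) :
    ∃ M : Matrix (Fin n) (Fin n) k, M.IsSymm ∧
      Polynomial.aeval α M.charpoly = 0 := by
  have := IntermediateField.adjoin.finiteDimensional hint
  have : Algebra.IsSeparable k (IntermediateField.adjoin k {α}) :=
    (IntermediateField.isSeparable_adjoin_simple_iff_isSeparable k _).mpr hsep
  obtain ⟨b, hb⟩ := Algebra.exists_basis_traceForm_orthonormal_of_charTwo k
    (IntermediateField.adjoin k {α}) ((IntermediateField.adjoin.finrank hint).trans hdeg)
  set g := IntermediateField.AdjoinSimple.gen k α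
  refine ⟨Algebra.leftMulMatrix b g,
    Algebra.leftMulMatrix_isSymm_of_traceForm_orthonormal b hb g, ?_⟩
  have hg : aeval g (Algebra.leftMulMatrix b g).charpoly = 0 := by
    apply Algebra.leftMulMatrix_injective b
    rw [← aeval_algHom_apply, Matrix.aeval_self_charpoly, map_zero]
  have h := congrArg (IntermediateField.adjoin k {α}).val hg
  rwa [← aeval_algHom_apply, map_zero] at h
end
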